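/- Let (A_i)_{i∈ℕ} be Lebesgue-measurable subsets of [0,1]^d with ∑_i λ(A_i) = ∞, suppose there exists C > 0 with ∑_{s,t=1}^{Q} λ(A_s ∩ A_t) ≤ C(∑_{s=1}^{Q} λ(A_s))² for infinitely many Q, and suppose that for any δ > 0 and any closed ball B ⊆ [0,1]^d there exists i₀ such that λ(B ∩ A_i) ≤ (1+δ)λ(B)λ(A_i) for all i ≥ i₀. Then λ(limsup_{i→∞} A_i) = 1. -/

import Mathlib

open MeasureTheory Filter

section General

variable {α : Type*} [MeasurableSpace α] {μ : Measure α}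

/-- Cauchy–Schwarz for a sum of indicators against the indicator of `R`. -/
lemma sq_sum_measureReal_inter_le {ι : Type*} (s : Finset ι) {A : ι → Set α}
    (hA : ∀ i, MeasurableSet (A i)) (hA' : ∀ i, μ (A i) ≠ ⊤)
    {R : Set α} (hR : MeasurableSet R) (hR' : μ R ≠ ⊤) :
    (∑ i ∈ s, μ.real (A i ∩ R)) ^ 2 ≤
      (∑ i ∈ s, ∑ j ∈ s, μ.real (A i ∩ A j)) * μ.real R := by
  have h := real_inner_mul_inner_self_le
    (∑ i ∈ s, indicatorConstLp 2 (hA i) (hA' i) (1 : ℝ)) (indicatorConstLp 2 hR hR' (1 : ℝ))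
  simp only [sum_inner, inner_sum,
    L2.real_inner_indicatorConstLp_one_indicatorConstLp_one, Set.inter_self] at h
  rw [Finset.sum_comm (f := fun i j => μ.real (A i ∩ A j)), sq]
  simpa only [Set.inter_comm] using h

lemma exists_sum_Icc_le_add_mul {f g : ℕ → ℝ} {c : ℝ} (hf : ∀ i, 0 ≤ f i) (hg : ∀ i, 0 ≤ g i)
    (hc : 0 ≤ c) (h : ∀ᶠ i in atTop, f i ≤ c * g i) :
    ∃ K : ℝ, ∀ Q, ∑ i ∈ Finset.Icc 1 Q, f i ≤ K + c * ∑ i ∈ Finset.Icc 1 Q, g i := by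
  obtain ⟨n, hn⟩ := eventually_atTop.1 h
  refine ⟨∑ i ∈ Finset.range n, f i, fun Q => ?_⟩
  calc ∑ i ∈ Finset.Icc 1 Q, f i
      ≤ ∑ i ∈ Finset.Icc 1 Q, ((if i < n then f i else 0) + c * g i) := by
        refine Finset.sum_le_sum fun i _ => ?_
        split_ifs with hi
        · exact le_add_of_nonneg_right (mul_nonneg hc (hg i))
        · simpa using hn i (not_lt.1 hi)
    _ ≤ _ := by
        rw [Finset.sum_add_distrib, ← Finset.mul_sum, ← Finset.sum_filter]
        refine add_le_add_left (Finset.sum_le_sum_of_subset_of_nonneg (fun i hi => ?_)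
          fun i _ _ => hf i) _
        simp_all

lemma tendsto_sum_Icc_measureReal_atTop {A : ℕ → Set α} (hA' : ∀ i, μ (A i) ≠ ⊤)
    (hdiv : ∑' i, μ (A i) = ⊤) :
    Tendsto (fun Q => ∑ i ∈ Finset.Icc 1 Q, μ.real (A i)) atTop atTop := by
  have hns : ¬ Summable fun i => μ.real (A i) := fun hs => by
    apply hs.tsum_ofReal_ne_top
    simpa [hA'] using hdiv
  have h := (not_summable_iff_tendsto_nat_atTop_of_nonneg fun i => measureReal_nonneg).1 hns
  have h2 := tendsto_atTop_add_const_right atTop (-μ.real (A 0))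
    (h.comp (tendsto_add_atTop_nat 1))
  refine h2.congr fun Q => ?_
  have : Finset.range (Q + 1) = insert 0 (Finset.Icc 1 Q) := by
    ext i; simp; omega
  simp [this]

/-- If quasi-independent sets with divergent measure sum are covered by `G ∪ R`, they cannot have
asymptotically small density in `G` while `R` has small measure. -/
lemma one_le_add_of_quasiIndependent {A : ℕ → Set α} (hA : ∀ i, MeasurableSet (A i))
    (hA' : ∀ i, μ (A i) ≠ ⊤) (hdiv : ∑' i, μ (A i) = ⊤) {C : ℝ}
    (hqi : ∃ᶠ Q in atTop, ∑ s ∈ Finset.Icc 1 Q, ∑ t ∈ Finset.Icc 1 Q,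
      μ.real (A s ∩ A t) ≤ C * (∑ s ∈ Finset.Icc 1 Q, μ.real (A s)) ^ 2)
    {G R : Set α} (hR : MeasurableSet R) (hR' : μ R ≠ ⊤) (hGR : ∀ i, A i ⊆ G ∪ R)
    {c η : ℝ} (hc : 0 ≤ c) (hη : 0 ≤ η) (hCR : C * μ.real R ≤ η ^ 2)
    (hG : ∀ᶠ i in atTop, μ.real (A i ∩ G) ≤ c * μ.real (A i)) :
    1 ≤ c + η := by
  by_contra! hlt
  obtain ⟨K, hK⟩ := exists_sum_Icc_le_add_mul (fun i => measureReal_nonneg)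
    (fun i => measureReal_nonneg) hc hG
  have hS := tendsto_sum_Icc_measureReal_atTop hA' hdiv
  obtain ⟨Q, hQ, hQK⟩ := (hqi.and_eventually
    (hS.eventually_gt_atTop (max 0 (K / (1 - c - η))))).exists
  set S := ∑ i ∈ Finset.Icc 1 Q, μ.real (A i) with hSdef
  have hS0 : 0 < S := (le_max_left _ _).trans_lt hQK
  have hSK : K < S * (1 - c - η) :=
    (div_lt_iff₀ (by linarith)).1 ((le_max_right _ _).trans_lt hQK)
  have hN : ∑ i ∈ Finset.Icc 1 Q, μ.real (A i ∩ R) ≤ η * S := by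
    refine le_of_sq_le_sq ?_ (by positivity)
    calc _ ≤ _ := sq_sum_measureReal_inter_le _ hA hA' hR hR'
      _ ≤ C * S ^ 2 * μ.real R := by gcongr
      _ = C * μ.real R * S ^ 2 := by ring
      _ ≤ η ^ 2 * S ^ 2 := by gcongr
      _ = (η * S) ^ 2 := by ring
  have hsplit : S ≤ ∑ i ∈ Finset.Icc 1 Q, μ.real (A i ∩ G) +
      ∑ i ∈ Finset.Icc 1 Q, μ.real (A i ∩ R) := by
    rw [← Finset.sum_add_distrib]
    refine Finset.sum_le_sum fun i _ => ?_
    calc μ.real (A i) ≤ μ.real (A i ∩ G ∪ A i ∩ R) := by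
          refine measureReal_mono ?_ ?_
          · rw [← Set.inter_union_distrib_left]
            exact Set.subset_inter subset_rfl (hGR i)
          · rw [← Set.inter_union_distrib_left]
            exact measure_ne_top_of_subset Set.inter_subset_left (hA' i)
      _ ≤ _ := measureReal_union_le _ _
  have := hK Q
  nlinarith

end General

section Cube

variable {ι : Type*}

lemma EuclideanSpace.isClosed_unitCube :
    IsClosed {x : EuclideanSpace ℝ ι | ∀ j, x j ∈ Set.Icc (0 : ℝ) 1} := by
  simp only [Set.ofPred_forall]
  exact isClosed_iInter fun j => isClosed_Icc.preimage (by fun_prop)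

lemma EuclideanSpace.convex_unitCube :
    Convex ℝ {x : EuclideanSpace ℝ ι | ∀ j, x j ∈ Set.Icc (0 : ℝ) 1} := by
  intro x hx y hy a b ha hb hab j
  simpa using (convex_Icc (0 : ℝ) 1) (hx j) (hy j) ha hb hab

lemma EuclideanSpace.volume_unitCube [Fintype ι] :
    volume {x : EuclideanSpace ℝ ι | ∀ j, x j ∈ Set.Icc (0 : ℝ) 1} = 1 := by
  have h := (PiLp.volume_preserving_ofLp ι).measure_preimage
    (s := Set.univ.pi fun _ => Set.Icc (0 : ℝ) 1)
    (MeasurableSet.univ_pi fun _ => measurableSet_Icc).nullMeasurableSet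
  rw [volume_pi_pi] at h
  simpa [Set.preimage, Set.mem_pi, Pi.le_def, forall_and] using h

end Cube

/-- A family of closed balls inside `U` covering `s` efficiently. -/
lemma exists_closedBall_subset_covering {E : Type*} [NormedAddCommGroup E] [NormedSpace ℝ E]
    [FiniteDimensional ℝ E] [MeasurableSpace E] [BorelSpace E] (μ : Measure E)
    [IsFiniteMeasureOnCompacts μ] {ε : ENNReal} (hε : ε ≠ 0) {s U : Set E}
    (hU : IsOpen U) (hs : s ⊆ U) :
    ∃ (t : Set E) (r : E → ℝ), t.Countable ∧ (∀ x ∈ t, 0 < r x ∧ Metric.closedBall x (r x) ⊆ U) ∧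
      (s ⊆ ⋃ x ∈ t, Metric.closedBall x (r x)) ∧
      ∑' x : t, μ (Metric.closedBall x (r x)) ≤ μ s + ε := by
  obtain ⟨t, r, ht, -, hr, hcov, hsum⟩ := Besicovitch.exists_closedBall_covering_tsum_measure_le μ hε
    (fun x => {ρ | 0 < ρ ∧ Metric.closedBall x ρ ⊆ U}) s fun x hx δ hδ => by
      obtain ⟨ρ, hρ, hρU⟩ := Metric.nhds_basis_closedBall.mem_iff.1 (hU.mem_nhds (hs hx))
      refine ⟨min ρ (δ / 2), ⟨lt_min hρ (by linarith), ?_⟩, lt_min hρ (by linarith), ?_⟩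
      · exact (Metric.closedBall_subset_closedBall (min_le_left _ _)).trans hρU
      · exact (min_le_right _ _).trans_lt (by linarith)
  exact ⟨t, r, ht, hr, hcov, hsum⟩

/-- Finitely many of the sets `B x`, together with the set of points avoiding all `A i` for `i ≥ n`,
exhaust `U` up to small measure, provided that the `B x` cover `limsup A` inside `U` a.e. -/
lemma exists_finset_measure_diff_lt {α ι : Type*} [MeasurableSpace α] {μ : Measure α} [Countable ι]
    {U : Set α} (hU : MeasurableSet U) (hU' : μ U ≠ ⊤) {A : ℕ → Set α}
    (hA : ∀ i, MeasurableSet (A i)) {B : ι → Set α} (hB : ∀ x, MeasurableSet (B x))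
    (hcov : μ ((U ∩ limsup A atTop) \ ⋃ x, B x) = 0) {ε : ENNReal} (hε : 0 < ε) :
    ∃ (T : Finset ι) (n : ℕ), μ (U \ ((⋃ x ∈ T, B x) ∪ (⋃ i ≥ n, A i)ᶜ)) < ε := by
  classical
  let H : Finset ι × ℕ → Set α := fun p => U \ ((⋃ x ∈ p.1, B x) ∪ (⋃ i ≥ p.2, A i)ᶜ)
  have hH : Antitone H := by
    rintro ⟨T, n⟩ ⟨T', n'⟩ ⟨hT, hn⟩
    refine Set.sdiff_subset_sdiff_right (Set.union_subset_union ?_ (Set.compl_subset_compl.2 ?_))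
    · exact Set.biUnion_subset_biUnion_left hT
    · exact Set.biUnion_subset_biUnion_left fun i hi => le_trans hn hi
  have hHm : ∀ p, MeasurableSet (H p) := fun p =>
    hU.diff ((Finset.measurableSet_biUnion _ fun x _ => hB x).union
      (MeasurableSet.iUnion fun i => MeasurableSet.iUnion fun _ => hA i).compl)
  have hlim := tendsto_measure_iInter_atTop (μ := μ) (fun p => (hHm p).nullMeasurableSet) hH
    ⟨(∅, 0), measure_ne_top_of_subset Set.sdiff_subset hU'⟩
  have hzero : μ (⋂ p, H p) = 0 := by
    refine measure_mono_null (fun y hy => ?_) hcov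
    simp only [H, Set.mem_iInter, Prod.forall] at hy
    refine ⟨⟨(hy ∅ 0).1, ?_⟩, fun hyB => ?_⟩
    · simp only [limsup_eq_iInf_iSup_of_nat, Set.iInf_eq_iInter, Set.iSup_eq_iUnion,
        Set.mem_iInter]
      intro n
      by_contra hn
      exact (hy ∅ n).2 (Or.inr hn)
    · obtain ⟨x, hx⟩ := Set.mem_iUnion.1 hyB
      exact (hy {x} 0).2 (Or.inl (by simpa using hx))
  rw [hzero] at hlim
  obtain ⟨p, hp⟩ := (hlim.eventually_lt_const hε).exists
  exact ⟨p.1, p.2, hp⟩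

theorem borel_cantelli_full_measure (d : ℕ) (hd : 0 < d)
    (A : ℕ → Set (EuclideanSpace ℝ (Fin d)))
    (hmeas : ∀ i, MeasurableSet (A i))
    (hsub : ∀ i, A i ⊆ {x | ∀ j, x j ∈ Set.Icc (0 : ℝ) 1})
    (hdiv : ∑' i, volume (A i) = ⊤)
    (hqi : ∃ C : ℝ, 0 < C ∧ ∃ᶠ Q in atTop, ∑ s ∈ Finset.Icc 1 Q, ∑ t ∈ Finset.Icc 1 Q,
      (volume (A s ∩ A t)).toReal ≤ C * (∑ s ∈ Finset.Icc 1 Q, (volume (A s)).toReal) ^ 2)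
    (heq : ∀ δ : ℝ, 0 < δ → ∀ (x : EuclideanSpace ℝ (Fin d)) (rad : ℝ), 0 < rad →
      Metric.closedBall x rad ⊆ {x | ∀ j, x j ∈ Set.Icc (0 : ℝ) 1} →
      ∃ i₀ : ℕ, ∀ i ≥ i₀, (volume (Metric.closedBall x rad ∩ A i)).toReal ≤
        (1 + δ) * (volume (Metric.closedBall x rad)).toReal * (volume (A i)).toReal) :
    volume (limsup A atTop) = 1 := by
  set U : Set (EuclideanSpace ℝ (Fin d)) := {x | ∀ j, x j ∈ Set.Icc (0 : ℝ) 1} with hUdef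
  have hU1 : volume U = 1 := EuclideanSpace.volume_unitCube
  have hUc : IsClosed U := EuclideanSpace.isClosed_unitCube
  have hfr : volume (frontier U) = 0 := EuclideanSpace.convex_unitCube.addHaar_frontier volume
  have hfin : ∀ {s}, s ⊆ U → volume s ≠ ⊤ := fun hs =>
    measure_ne_top_of_subset hs (by simp [hU1])
  have hA' : ∀ i, volume (A i) ≠ ⊤ := fun i => hfin (hsub i)
  obtain ⟨C, hC, hqi⟩ := hqi
  have hEU : limsup A atTop ⊆ U := by
    rw [limsup_eq_iInf_iSup_of_nat]
    exact (iInf_le _ 0).trans (iSup₂_le fun i _ => hsub i)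
  refine le_antisymm (hU1 ▸ measure_mono hEU) ?_
  by_contra! hlt
  set m := volume.real (limsup A atTop) with hm
  have hm0 : 0 ≤ m := measureReal_nonneg
  have hm1 : m < 1 := by
    rw [hm, measureReal_def, ← ENNReal.toReal_one]
    exact (ENNReal.toReal_lt_toReal (hfin hEU) ENNReal.one_ne_top).2 hlt
  obtain ⟨ε, hε, hε8⟩ : ∃ ε : ℝ, 0 < ε ∧ 8 * ε = 1 - m := ⟨(1 - m) / 8, by linarith, by ring⟩
  obtain ⟨t, r, ht, hr, hcov, hsum⟩ := exists_closedBall_subset_covering volume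
    (ε := ENNReal.ofReal ε) (by simpa using hε) (s := limsup A atTop ∩ interior U)
    isOpen_interior Set.inter_subset_right
  have := ht.to_subtype
  obtain ⟨T, n, hTn⟩ := exists_finset_measure_diff_lt (μ := volume) hUc.measurableSet
    (hfin subset_rfl) hmeas (B := fun x : t => Metric.closedBall (x : EuclideanSpace ℝ (Fin d)) (r x))
    (fun x => Metric.isClosed_closedBall.measurableSet)
    (measure_mono_null (fun y hy => by
      rw [hUc.frontier_eq]
      refine ⟨hy.1.1, fun hyI => hy.2 ?_⟩
      simpa using hcov ⟨hy.1.2, hyI⟩) hfr)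
    (ε := ENNReal.ofReal (ε ^ 2 / C)) (by simpa using by positivity)
  have hT : ∑ x ∈ T, volume.real (Metric.closedBall (x : EuclideanSpace ℝ (Fin d)) (r x))
      ≤ m + ε := by
    have h1 := (ENNReal.sum_le_tsum T).trans
      (hsum.trans (add_le_add_left (measure_mono Set.inter_subset_left) _))
    have h2 := ENNReal.toReal_mono (by finiteness [hfin hEU]) h1
    rwa [ENNReal.toReal_add (hfin hEU) (by simp), ENNReal.toReal_ofReal hε.le,
      ENNReal.toReal_sum fun x _ => measure_closedBall_lt_top.ne] at h2
  have hbad := one_le_add_of_quasiIndependent (η := ε) (c := (1 + ε) * (m + ε)) hmeas hA' hdiv hqi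
    (G := (⋃ x ∈ T, Metric.closedBall (x : EuclideanSpace ℝ (Fin d)) (r x)) ∪ (⋃ i ≥ n, A i)ᶜ)
    (hUc.measurableSet.diff ((Finset.measurableSet_biUnion _ fun x _ =>
      Metric.isClosed_closedBall.measurableSet).union
      (MeasurableSet.iUnion fun i => MeasurableSet.iUnion fun _ => hmeas i).compl))
    (hfin Set.sdiff_subset)
    (fun i => by rw [Set.union_sdiff_self]; exact (hsub i).trans Set.subset_union_right)
    (by positivity) hε.le
    (by
      have := ENNReal.toReal_mono ENNReal.ofReal_ne_top hTn.le
      rw [ENNReal.toReal_ofReal (by positivity), le_div_iff₀ hC] at this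
      rwa [mul_comm])
    (by
      have hball : ∀ᶠ i in atTop, ∀ x ∈ T,
          volume.real (Metric.closedBall (x : EuclideanSpace ℝ (Fin d)) (r x) ∩ A i) ≤
          (1 + ε) * volume.real (Metric.closedBall (x : EuclideanSpace ℝ (Fin d)) (r x)) *
            volume.real (A i) :=
        (Finset.eventually_all T).2 fun x _ => eventually_atTop.2
          (heq ε hε x (r x) (hr x x.2).1 ((hr x x.2).2.trans interior_subset))
      filter_upwards [hball, eventually_ge_atTop n] with i hi hin
      calc _ ≤ volume.real (⋃ x ∈ T,
            (Metric.closedBall (x : EuclideanSpace ℝ (Fin d)) (r x) ∩ A i)) := by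
            refine measureReal_mono ?_ (hfin ?_)
            · rintro y ⟨hyA, hy | hy⟩
              · simp only [Set.mem_iUnion] at hy ⊢
                obtain ⟨x, hx, hy⟩ := hy
                exact ⟨x, hx, hy, hyA⟩
              · exact absurd (Set.mem_biUnion (show i ∈ {i | i ≥ n} from hin) hyA) hy
            · exact Set.iUnion₂_subset fun x _ => Set.inter_subset_right.trans (hsub i)
        _ ≤ ∑ x ∈ T, volume.real
              (Metric.closedBall (x : EuclideanSpace ℝ (Fin d)) (r x) ∩ A i) :=
            measureReal_biUnion_finset_le _ _
        _ ≤ _ := Finset.sum_le_sum hi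
        _ = (1 + ε) * (∑ x ∈ T, volume.real
              (Metric.closedBall (x : EuclideanSpace ℝ (Fin d)) (r x))) * volume.real (A i) := by
            rw [Finset.mul_sum, Finset.sum_mul]
        _ ≤ _ := by gcongr)
  nlinarith
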